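/- Let ψ be a complete Bernstein function which is smooth on (0,∞) with ψ' > 0, and define θ_λ = (1/π) ∫_0^1 (1/(1−ζ²)) log(ψ_λ(λ²/ζ²)/ψ_λ(λ²ζ²)) dζ with ψ_λ(ξ) = (1 − ξ/λ²)/(1 − ψ(ξ)/ψ(λ²)) extended continuously at ξ = λ². Then for all λ > 0: (inf_{ξ>0} ξ|ψ''(ξ)|/ψ'(ξ)) · π/4 ≤ θ_λ ≤ (sup_{ξ>0} ξ|ψ''(ξ)|/ψ'(ξ)) · π/4. -/

import Mathlib

open Real MeasureTheory

/-- A complete Bernstein function: `f(z) = c₁ + c₂ z + (1/π) ∫_{(0,∞)} z/(z+s) · m(ds)/s`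
with `c₁, c₂ ≥ 0` and `∫ min(s⁻¹, s⁻²) m(ds) < ∞`. -/
def IsCompleteBernstein (f : ℝ → ℝ) : Prop :=
  ∃ (c₁ c₂ : ℝ) (m : Measure ℝ), 0 ≤ c₁ ∧ 0 ≤ c₂ ∧
    (∫⁻ s in Set.Ioi (0:ℝ), ENNReal.ofReal (min s⁻¹ (s^2)⁻¹) ∂m) ≠ ⊤ ∧
    ∀ z > (0:ℝ), f z = c₁ + c₂ * z +
      (1/π) * ∫ s in Set.Ioi (0:ℝ), z/(z+s) * s⁻¹ ∂m

/-- `ψ_λ(ξ) = (1 − ξ/λ²)/(1 − ψ(ξ)/ψ(λ²))`. -/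
noncomputable def psiLam (ψ : ℝ → ℝ) (lam ξ : ℝ) : ℝ :=
  (1 - ξ/lam^2) / (1 - ψ ξ / ψ (lam^2))

open Set

lemma inv_conv {X Y a b : ℝ} (hX : 0 < X) (hY : 0 < Y) (ha : 0 ≤ a) (hb : 0 ≤ b)
    (hab : a + b = 1) : (a*X+b*Y)⁻¹ ≤ a * X⁻¹ + b * Y⁻¹ := by
  have := (convexOn_zpow (𝕜 := ℝ) (-1)).2 (x := X) hX (y := Y) hY ha hb hab
  simpa [zpow_neg] using this

lemma pieces {m : Measure ℝ}
    (hm : (∫⁻ s in Set.Ioi (0:ℝ), ENNReal.ofReal (min s⁻¹ (s^2)⁻¹) ∂m) ≠ ⊤) {z : ℝ} (hz : 0 < z) :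
    IntegrableOn (fun s => z/(z+s) * s⁻¹) (Ioi 0) m := by
  have h1 : IntegrableOn (fun s : ℝ => min s⁻¹ (s^2)⁻¹) (Ioi 0) m := by
    refine ⟨by fun_prop, ?_⟩
    rw [hasFiniteIntegral_iff_ofReal]
    · exact lt_top_iff_ne_top.2 hm
    · filter_upwards [ae_restrict_mem measurableSet_Ioi] with s hs
      have : 0 < s := hs
      simp only [Pi.zero_apply]
      positivity
  refine (h1.const_mul (max 1 z)).mono' (by fun_prop) ?_
  filter_upwards [ae_restrict_mem measurableSet_Ioi] with s hs
  have hs : 0 < s := hs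
  rw [Real.norm_of_nonneg (by positivity), mul_min_of_nonneg _ _ (by positivity), le_min_iff]
  constructor
  · gcongr
    refine le_trans ?_ (le_max_left _ _)
    rw [div_le_one (by positivity)]; linarith
  · rw [pow_two, mul_inv, ← mul_assoc]
    gcongr
    rw [← div_eq_mul_inv]
    gcongr
    · exact le_max_right _ _
    · linarith

lemma concave_cb {ψ : ℝ → ℝ} (h : IsCompleteBernstein ψ) : ConcaveOn ℝ (Ioi 0) ψ := by
  obtain ⟨c₁, c₂, m, h1, h2, hm, hf⟩ := h
  refine ⟨convex_Ioi 0, ?_⟩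
  intro x hx y hy a b ha hb hab
  have hx : 0 < x := hx
  have hy : 0 < y := hy
  have hw : 0 < a * x + b * y := (convex_Ioi (0:ℝ)) hx hy ha hb hab
  simp only [smul_eq_mul]
  rw [hf x hx, hf y hy, hf _ hw]
  have key : a * (∫ s in Set.Ioi (0:ℝ), x/(x+s) * s⁻¹ ∂m) + b * (∫ s in Set.Ioi (0:ℝ), y/(y+s) * s⁻¹ ∂m)
      ≤ ∫ s in Set.Ioi (0:ℝ), (a * x + b * y)/((a * x + b * y)+s) * s⁻¹ ∂m := by
    rw [← integral_const_mul, ← integral_const_mul, ← integral_add ((pieces hm hx).const_mul a) ((pieces hm hy).const_mul b)]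
    refine setIntegral_mono_on (((pieces hm hx).const_mul a).add ((pieces hm hy).const_mul b)) (pieces hm hw) measurableSet_Ioi ?_
    intro s hs
    have hs : 0 < s := hs
    have e : ∀ z : ℝ, 0 < z → z/(z+s) * s⁻¹ = s⁻¹ - (z+s)⁻¹ := by
      intro z hz; field_simp; ring
    rw [e x hx, e y hy, e _ hw]
    have := inv_conv (X := x+s) (Y := y+s) (by positivity) (by positivity) ha hb hab
    have e2 : a*(x+s)+b*(y+s) = a*x+b*y+s := by linear_combination s * hab
    rw [e2] at this
    have e3 : s⁻¹ = a * s⁻¹ + b * s⁻¹ := by rw [← add_mul, hab, one_mul]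
    linarith
  have := mul_le_mul_of_nonneg_left key (show 0 ≤ 1/π by positivity)
  have e4 : c₁ = a * c₁ + b * c₁ := by rw [← add_mul, hab, one_mul]
  linarith

lemma convex_cb {ψ : ℝ → ℝ} (h : IsCompleteBernstein ψ) : ConvexOn ℝ (Ioi 0) (fun u => ψ u⁻¹) := by
  obtain ⟨c₁, c₂, m, h1, h2, hm, hf⟩ := h
  refine ⟨convex_Ioi 0, ?_⟩
  intro x hx y hy a b ha hb hab
  have hx : 0 < x := hx
  have hy : 0 < y := hy
  have hw : 0 < a * x + b * y := (convex_Ioi (0:ℝ)) hx hy ha hb hab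
  simp only [smul_eq_mul]
  have hx' := inv_pos.2 hx
  have hy' := inv_pos.2 hy
  have hw' := inv_pos.2 hw
  rw [hf _ hx', hf _ hy', hf _ hw']
  have key : ∫ s in Set.Ioi (0:ℝ), (a * x + b * y)⁻¹/((a * x + b * y)⁻¹+s) * s⁻¹ ∂m ≤ a * (∫ s in Set.Ioi (0:ℝ), x⁻¹/(x⁻¹+s) * s⁻¹ ∂m) + b * (∫ s in Set.Ioi (0:ℝ), y⁻¹/(y⁻¹+s) * s⁻¹ ∂m) := by
    rw [← integral_const_mul, ← integral_const_mul, ← integral_add ((pieces hm hx').const_mul a) ((pieces hm hy').const_mul b)]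
    refine setIntegral_mono_on (pieces hm hw') (((pieces hm hx').const_mul a).add ((pieces hm hy').const_mul b)) measurableSet_Ioi ?_
    intro s hs
    have hs : 0 < s := hs
    have e : ∀ z : ℝ, 0 < z → z⁻¹/(z⁻¹+s) * s⁻¹ = (1+s*z)⁻¹ * s⁻¹ := by
      intro z hz; field_simp
    rw [e x hx, e y hy, e _ hw]
    have := inv_conv (X := 1+s*x) (Y := 1+s*y) (by positivity) (by positivity) ha hb hab
    have e2 : a*(1+s*x)+b*(1+s*y) = 1+s*(a*x+b*y) := by linear_combination hab
    rw [e2] at this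
    have := mul_le_mul_of_nonneg_right this (inv_pos.2 hs).le
    linarith
  have := mul_le_mul_of_nonneg_left key (show 0 ≤ 1/π by positivity)
  have e4 : c₁ = a * c₁ + b * c₁ := by rw [← add_mul, hab, one_mul]
  have e5 := mul_le_mul_of_nonneg_left (inv_conv hx hy ha hb hab) h2
  linarith

lemma nonneg_cb {ψ : ℝ → ℝ} (h : IsCompleteBernstein ψ) {z : ℝ} (hz : 0 < z) : 0 ≤ ψ z := by
  obtain ⟨c₁, c₂, m, h1, h2, hm, hf⟩ := h
  rw [hf z hz]
  have : 0 ≤ ∫ s in Set.Ioi (0:ℝ), z/(z+s) * s⁻¹ ∂m := by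
    refine setIntegral_nonneg measurableSet_Ioi fun s hs => ?_
    have hs : 0 < s := hs
    positivity
  positivity

lemma int_pow_log (n : ℕ) : IntegrableOn (fun x : ℝ => x^n * (-log x)) (Ioo 0 1) ∧
    ∫ x in Ioo (0:ℝ) 1, x^n * (-log x) = 1/((n:ℝ)+1)^2 := by
  set F : ℝ → ℝ := fun x => -(x^n * (x * log x))/((n:ℝ)+1) + x^(n+1)/((n:ℝ)+1)^2 with hF
  have hn : (n:ℝ)+1 ≠ 0 := by positivity
  have hc : ContinuousOn F (Icc 0 1) := by
    have := Real.continuous_mul_log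
    apply Continuous.continuousOn
    fun_prop
  have hd : ∀ x ∈ Ioo (0:ℝ) 1, HasDerivAt F (x^n * (-log x)) x := by
    intro x hx
    have hx0 : x ≠ 0 := hx.1.ne'
    have h1 : HasDerivAt (fun x : ℝ => x^(n+1) * log x) ((n+1:ℕ) * x^n * log x + x^(n+1) * x⁻¹) x := by
      exact (hasDerivAt_pow (n+1) x).mul (Real.hasDerivAt_log hx0)
    have h2 := ((h1.neg.div_const ((n:ℝ)+1)).add ((hasDerivAt_pow (n+1) x).div_const (((n:ℝ)+1)^2)))
    convert! h2 using 1
    · funext y; simp only [hF, Pi.add_apply, Pi.neg_apply]; ring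
    · simp only [Nat.add_sub_cancel]; push_cast; field_simp; ring
  have hp : ∀ x ∈ Ioo (0:ℝ) 1, 0 ≤ x^n * (-log x) := by
    intro x hx
    have := Real.log_nonpos hx.1.le hx.2.le
    have := hx.1
    apply mul_nonneg <;> [positivity; linarith]
  have hi := intervalIntegral.integrableOn_deriv_of_nonneg hc hd hp
  refine ⟨hi.mono_set Ioo_subset_Ioc_self, ?_⟩
  rw [← integral_Ioc_eq_integral_Ioo, ← intervalIntegral.integral_of_le zero_le_one,
    intervalIntegral.integral_eq_sub_of_hasDerivAt_of_le zero_le_one hc hd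
      ((intervalIntegrable_iff_integrableOn_Ioc_of_le zero_le_one).2 hi)]
  simp [hF]

lemma odd_sum : HasSum (fun n : ℕ => 1/((2*n:ℕ)+1:ℝ)^2) (π^2/8) := by
  have h := hasSum_zeta_two
  have he : HasSum (fun n : ℕ => (1:ℝ)/((2*n:ℕ):ℝ)^2) (π^2/24) := by
    convert! h.mul_left (1/4) using 1
    · funext n; push_cast; ring
    · ring
  have ho : Summable (fun n : ℕ => 1/((2*n+1:ℕ):ℝ)^2) :=
    h.summable.comp_injective (i := fun n : ℕ => 2*n+1) (fun a b h => by simp at h; exact h)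
  have := (he.even_add_odd (f := fun n : ℕ => (1:ℝ)/(n:ℝ)^2) ho.hasSum).unique h
  have e : ∑' n : ℕ, 1/((2*n+1:ℕ):ℝ)^2 = π^2/8 := by linarith
  have := e ▸ ho.hasSum
  simpa using this

lemma main_int : IntegrableOn (fun x : ℝ => 1/(1-x^2) * (-log x)) (Ioo 0 1) ∧
    ∫ x in Ioo (0:ℝ) 1, 1/(1-x^2) * (-log x) = π^2/8 := by
  have hp : ∀ n : ℕ, ∀ x ∈ Ioo (0:ℝ) 1, 0 ≤ x^n * (-log x) := by
    intro n x hx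
    have := Real.log_nonpos hx.1.le hx.2.le
    have := hx.1
    apply mul_nonneg <;> [positivity; linarith]
  have h := hasSum_integral_of_summable_integral_norm (μ := volume.restrict (Ioo (0:ℝ) 1))
    (F := fun (n:ℕ) (x:ℝ) => x^(2*n) * (-log x)) (fun n => (int_pow_log (2*n)).1) (by
      refine odd_sum.summable.congr fun n => ?_
      rw [← (int_pow_log (2*n)).2]
      exact setIntegral_congr_fun measurableSet_Ioo fun x hx => (Real.norm_of_nonneg (hp _ x hx)).symm)
  simp only [(int_pow_log _).2] at h
  have e := h.unique odd_sum
  have e2 : ∫ x in Ioo (0:ℝ) 1, 1/(1-x^2) * (-log x) = π^2/8 := by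
    rw [← e]
    refine setIntegral_congr_fun measurableSet_Ioo fun x hx => ?_
    have hx2 : x^2 < 1 := by nlinarith [hx.1, hx.2]
    simp only [pow_mul]
    rw [tsum_mul_right, tsum_geometric_of_lt_one (sq_nonneg x) hx2, one_div]
  refine ⟨?_, e2⟩
  apply Integrable.of_integral_ne_zero
  rw [e2]; positivity

/-- basic differential facts -/
lemma basic {ψ : ℝ → ℝ} (hcc : ConcaveOn ℝ (Ioi 0) ψ) (hcv : ConvexOn ℝ (Ioi 0) (fun u => ψ u⁻¹))
    (hd : ∀ x > 0, DifferentiableAt ℝ ψ x) (hdd : ∀ x > 0, DifferentiableAt ℝ (deriv ψ) x)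
    (x : ℝ) (hx : 0 < x) : deriv (deriv ψ) x ≤ 0 ∧ -(x * deriv (deriv ψ) x) ≤ 2 * deriv ψ x := by
  constructor
  · have := (hcc.antitoneOn_deriv hd).derivWithin_nonpos (x := x)
    rwa [derivWithin_of_isOpen isOpen_Ioi hx] at this
  · have hD : ∀ u > 0, HasDerivAt (fun u => ψ u⁻¹) (deriv ψ u⁻¹ * (-(u^2)⁻¹)) u := by
      intro u hu
      exact (hd _ (inv_pos.2 hu)).hasDerivAt.comp u (hasDerivAt_inv hu.ne')
    have hm := hcv.monotoneOn_deriv (fun u hu => (hD u hu).differentiableAt)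
    have hM : MonotoneOn (fun z => z^2 * deriv ψ z) (Ioi 0) := by
      intro y hy z hz hyz
      have hy : 0 < y := hy
      have hz : 0 < z := hz
      have := hm (inv_pos.2 hz) (inv_pos.2 hy) (inv_anti₀ hy hyz)
      rw [(hD _ (inv_pos.2 hz)).deriv, (hD _ (inv_pos.2 hy)).deriv] at this
      simp only [inv_inv, inv_pow] at this
      simp only
      linarith
    have := hM.derivWithin_nonneg (x := x)
    rw [derivWithin_of_isOpen isOpen_Ioi hx] at this
    have h2 := ((hasDerivAt_pow 2 x).mul (hdd x hx).hasDerivAt).deriv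
    have h3 : ((fun z => z^2) * deriv ψ : ℝ → ℝ) = (fun z => z^2 * deriv ψ z) := rfl
    rw [h3] at h2
    rw [h2] at this
    norm_num at this
    have h4 : 0 ≤ x * (2 * deriv ψ x + x * deriv (deriv ψ) x) := by nlinarith
    have := nonneg_of_mul_nonneg_right h4 hx
    linarith

lemma upper {ψ : ℝ → ℝ} (hd : ∀ x > 0, DifferentiableAt ℝ ψ x)
    (hdd : ∀ x > 0, DifferentiableAt ℝ (deriv ψ) x) (σ : ℝ) (κ : ℝ)
    (hk : ∀ x > 0, 0 ≤ σ * (κ * deriv ψ x + x * deriv (deriv ψ) x)) {a t : ℝ} (ha : 0 < a)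
    (ht : 0 < t) (ht1 : t < 1) :
    σ * (ψ a - ψ (a*t)) ≤ σ * (t^(1-κ) * (ψ (a/t) - ψ a)) := by
  have hM : MonotoneOn (fun x => σ * (x^κ * deriv ψ x)) (Ioi 0) := by
    have hD : ∀ x > 0, HasDerivAt (fun x => σ * (x^κ * deriv ψ x))
        (σ * (κ * x^(κ-1) * deriv ψ x + x^κ * deriv (deriv ψ) x)) x := fun x hx =>
      ((Real.hasDerivAt_rpow_const (Or.inl hx.ne')).mul (hdd x hx).hasDerivAt).const_mul σ
    apply monotoneOn_of_deriv_nonneg (convex_Ioi 0)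
    · exact fun x hx => (hD x hx).continuousAt.continuousWithinAt
    · rw [interior_Ioi]; exact fun x hx => (hD x hx).differentiableAt.differentiableWithinAt
    · rw [interior_Ioi]; intro x hx
      have hx : 0 < x := hx
      rw [(hD x hx).deriv]
      have : x^κ = x^(κ-1) * x := by rw [Real.rpow_sub_one hx.ne']; field_simp
      rw [this]
      have := mul_nonneg (Real.rpow_nonneg hx.le (κ-1)) (hk x hx)
      linarith
  have hM2 : MonotoneOn (fun x => σ * (t^(1-κ) * ψ x - ψ (x*t))) (Ioi 0) := by
    have hD : ∀ x > 0, HasDerivAt (fun x => σ * (t^(1-κ) * ψ x - ψ (x*t)))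
        (σ * (t^(1-κ) * deriv ψ x - deriv ψ (x*t) * t)) x := by
      intro x hx
      have h1 : HasDerivAt (fun x => ψ (x*t)) (deriv ψ (x*t) * t) x := by
        have h0 : HasDerivAt (fun x : ℝ => x * t) t x := by
          simpa using (hasDerivAt_id' x).mul_const t
        exact (hd (x*t) (by positivity)).hasDerivAt.comp x h0
      exact (((hd x hx).hasDerivAt.const_mul _).sub h1).const_mul σ
    apply monotoneOn_of_deriv_nonneg (convex_Ioi 0)
    · exact fun x hx => (hD x hx).continuousAt.continuousWithinAt
    · rw [interior_Ioi]; exact fun x hx => (hD x hx).differentiableAt.differentiableWithinAt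
    · rw [interior_Ioi]; intro x hx
      have hx : 0 < x := hx
      rw [(hD x hx).deriv]
      have h := hM (show x*t ∈ Ioi 0 from mul_pos hx ht) hx (by nlinarith)
      simp only at h
      rw [Real.mul_rpow hx.le ht.le] at h
      have hxk := Real.rpow_pos_of_pos hx κ
      have htk := Real.rpow_pos_of_pos ht κ
      have e : t^(1-κ) * t^κ = t := by rw [← Real.rpow_add ht]; simp
      have e' : t^(1-κ) = t * (t^κ)⁻¹ := by rw [eq_mul_inv_iff_mul_eq₀ htk.ne', e]
      rw [e']
      have h3 : 0 ≤ x^κ * (σ * (deriv ψ x - t^κ * deriv ψ (x*t))) := by linarith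
      have h4 := nonneg_of_mul_nonneg_right h3 hxk
      have h5 := mul_nonneg (show 0 ≤ t * (t^κ)⁻¹ by positivity) h4
      convert! h5 using 1
      field_simp
  have hle : a ≤ a/t := by rw [le_div_iff₀ ht]; nlinarith
  have h := hM2 ha (show a/t ∈ Ioi 0 from div_pos ha ht) hle
  simp only [div_mul_cancel₀ a ht.ne'] at h
  linarith

theorem stmt17 (ψ : ℝ → ℝ) (hcb : IsCompleteBernstein ψ)
    (hsmooth : ContDiffOn ℝ (⊤ : ℕ∞) ψ (Set.Ioi 0))
    (hpos : ∀ ξ > (0:ℝ), 0 < deriv ψ ξ)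
    (lam : ℝ) (hlam : 0 < lam) :
    (⨅ ξ : Set.Ioi (0:ℝ), (ξ:ℝ) * |deriv (deriv ψ) ξ| / deriv ψ ξ) * (π/4) ≤
      (1/π) * (∫ ζ in Set.Ioo (0:ℝ) 1,
        (1/(1-ζ^2)) * Real.log (psiLam ψ lam (lam^2/ζ^2) / psiLam ψ lam (lam^2*ζ^2))) ∧
    (1/π) * (∫ ζ in Set.Ioo (0:ℝ) 1,
        (1/(1-ζ^2)) * Real.log (psiLam ψ lam (lam^2/ζ^2) / psiLam ψ lam (lam^2*ζ^2))) ≤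
      (⨆ ξ : Set.Ioi (0:ℝ), (ξ:ℝ) * |deriv (deriv ψ) ξ| / deriv ψ ξ) * (π/4) := by
  have hd : ∀ x > 0, DifferentiableAt ℝ ψ x := fun x hx =>
    ((hsmooth.differentiableOn (by simp)) x hx).differentiableAt (Ioi_mem_nhds hx)
  have hdd : ∀ x > 0, DifferentiableAt ℝ (deriv ψ) x := by
    have h2 : ContDiffOn ℝ 1 (deriv ψ) (Ioi 0) :=
      hsmooth.deriv_of_isOpen isOpen_Ioi (WithTop.coe_le_coe.2 (le_top : ((1:ℕ∞)+1) ≤ ⊤))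
    exact fun x hx => ((h2.differentiableOn (by simp)) x hx).differentiableAt (Ioi_mem_nhds hx)
  have hb := basic (concave_cb hcb) (convex_cb hcb) hd hdd
  have hcont : ContinuousOn ψ (Ioi 0) := hsmooth.continuousOn
  have hsm : StrictMonoOn ψ (Ioi 0) := by
    apply strictMonoOn_of_deriv_pos (convex_Ioi 0) hcont
    rw [interior_Ioi]; exact hpos
  set q : Ioi (0:ℝ) → ℝ := fun ξ => (ξ:ℝ) * |deriv (deriv ψ) ξ| / deriv ψ ξ with hq
  have hq0 : ∀ ξ, 0 ≤ q ξ := fun ξ => by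
    have h1 : (0:ℝ) < ξ := ξ.2
    have := hpos ξ h1
    simp only [hq]; positivity
  have hq2 : ∀ ξ, q ξ ≤ 2 := fun ξ => by
    have h1 : (0:ℝ) < ξ := ξ.2
    simp only [hq]
    rw [div_le_iff₀ (hpos ξ h1), abs_of_nonpos (hb ξ h1).1]
    linarith [(hb ξ h1).2]
  have hbb : BddBelow (range q) := ⟨0, by rintro _ ⟨ξ, rfl⟩; exact hq0 ξ⟩
  have hba : BddAbove (range q) := ⟨2, by rintro _ ⟨ξ, rfl⟩; exact hq2 ξ⟩
  set κ₀ := ⨅ ξ, q ξ with hκ₀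
  set κ₁ := ⨆ ξ, q ξ with hκ₁
  have : Nonempty (Ioi (0:ℝ)) := ⟨⟨1, Set.mem_Ioi.2 one_pos⟩⟩
  have hκ₀0 : 0 ≤ κ₀ := le_ciInf hq0
  have hup : ∀ x > 0, 0 ≤ (1:ℝ) * (κ₁ * deriv ψ x + x * deriv (deriv ψ) x) := by
    intro x hx
    have h := le_ciSup hba ⟨x, hx⟩
    simp only [hq] at h
    rw [div_le_iff₀ (hpos x hx), abs_of_nonpos (hb x hx).1] at h
    linarith
  have hlo : ∀ x > 0, 0 ≤ (-1:ℝ) * (κ₀ * deriv ψ x + x * deriv (deriv ψ) x) := by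
    intro x hx
    have h := ciInf_le hbb ⟨x, hx⟩
    simp only [hq] at h
    rw [le_div_iff₀ (hpos x hx), abs_of_nonpos (hb x hx).1] at h
    linarith
  have ha : 0 < lam^2 := by positivity
  set a := lam^2 with ha_def
  have hψa : 0 < ψ a :=
    lt_of_le_of_lt (nonneg_cb hcb (half_pos ha)) (hsm (half_pos ha) ha (half_lt_self ha))
  have hA : ∀ ζ ∈ Ioo (0:ℝ) 1, 0 < ψ a - ψ (a*ζ^2) := by
    intro ζ hζ
    have h0 : 0 < ζ := hζ.1
    have h1 : ζ^2 < 1 := by nlinarith [hζ.1, hζ.2]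
    exact sub_pos.2 (hsm (show 0 < a*ζ^2 by positivity) ha (by nlinarith))
  have hB : ∀ ζ ∈ Ioo (0:ℝ) 1, 0 < ψ (a/ζ^2) - ψ a := by
    intro ζ hζ
    have h0 : 0 < ζ := hζ.1
    have h1 : ζ^2 < 1 := by nlinarith [hζ.1, hζ.2]
    refine sub_pos.2 (hsm ha (show 0 < a/ζ^2 by positivity) ?_)
    rw [lt_div_iff₀ (by positivity)]; nlinarith
  have hR : ∀ ζ ∈ Ioo (0:ℝ) 1, psiLam ψ lam (a/ζ^2) / psiLam ψ lam (a*ζ^2) =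
      (ψ a - ψ (a*ζ^2)) / (ψ (a/ζ^2) - ψ a) / ζ^2 := by
    intro ζ hζ
    have h0 : 0 < ζ := hζ.1
    have h1 : 0 < 1 - ζ^2 := by nlinarith [hζ.1, hζ.2]
    have hA' := hA ζ hζ
    have hB' := hB ζ hζ
    unfold psiLam
    rw [← ha_def]
    have e1 : 1 - a/ζ^2/a = -((1-ζ^2)/ζ^2) := by field_simp; ring
    have e2 : 1 - a*ζ^2/a = 1-ζ^2 := by field_simp
    have e3 : 1 - ψ (a/ζ^2)/ψ a = -((ψ (a/ζ^2) - ψ a)/ψ a) := by field_simp; ring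
    have e4 : 1 - ψ (a*ζ^2)/ψ a = (ψ a - ψ (a*ζ^2))/ψ a := by field_simp
    rw [e1, e2, e3, e4, neg_div_neg_eq]
    field_simp
  have hle : ∀ ζ ∈ Ioo (0:ℝ) 1, Real.log (psiLam ψ lam (a/ζ^2) / psiLam ψ lam (a*ζ^2))
      ≤ 2 * κ₁ * (-log ζ) := by
    intro ζ hζ
    have h0 : 0 < ζ := hζ.1
    have h1 : ζ^2 < 1 := by nlinarith [hζ.1, hζ.2]
    have hA' := hA ζ hζ
    have hB' := hB ζ hζ
    rw [hR ζ hζ]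
    have h := upper hd hdd 1 κ₁ hup ha (pow_pos h0 2) h1
    rw [one_mul, one_mul, ← div_le_iff₀ hB'] at h
    have h2 := Real.log_le_log (by positivity) h
    rw [Real.log_rpow (by positivity), Real.log_pow] at h2
    rw [Real.log_div (by positivity) (by positivity), Real.log_pow]
    push_cast at *
    linarith
  have hge : ∀ ζ ∈ Ioo (0:ℝ) 1, 2 * κ₀ * (-log ζ) ≤
      Real.log (psiLam ψ lam (a/ζ^2) / psiLam ψ lam (a*ζ^2)) := by
    intro ζ hζ
    have h0 : 0 < ζ := hζ.1
    have h1 : ζ^2 < 1 := by nlinarith [hζ.1, hζ.2]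
    have hA' := hA ζ hζ
    have hB' := hB ζ hζ
    rw [hR ζ hζ]
    have h := upper hd hdd (-1) κ₀ hlo ha (pow_pos h0 2) h1
    have h : (ζ^2)^(1-κ₀) * (ψ (a/ζ^2) - ψ a) ≤ ψ a - ψ (a*ζ^2) := by linarith
    rw [← le_div_iff₀ hB'] at h
    have h2 := Real.log_le_log (by positivity) h
    rw [Real.log_rpow (by positivity), Real.log_pow] at h2
    rw [Real.log_div (by positivity) (by positivity), Real.log_pow]
    push_cast at *
    linarith
  obtain ⟨hI, hIv⟩ := main_int
  set G : ℝ → ℝ := fun ζ => (1/(1-ζ^2)) *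
    Real.log (psiLam ψ lam (a/ζ^2) / psiLam ψ lam (a*ζ^2)) with hG
  have hw : ∀ ζ ∈ Ioo (0:ℝ) 1, 0 < 1/(1-ζ^2) := by
    intro ζ hζ
    have : 0 < 1 - ζ^2 := by nlinarith [hζ.1, hζ.2]
    positivity
  have hGle : ∀ ζ ∈ Ioo (0:ℝ) 1, G ζ ≤ 2 * κ₁ * (1/(1-ζ^2) * (-log ζ)) := by
    intro ζ hζ
    have := mul_le_mul_of_nonneg_left (hle ζ hζ) (hw ζ hζ).le
    simp only [hG]; linarith
  have hGge : ∀ ζ ∈ Ioo (0:ℝ) 1, 2 * κ₀ * (1/(1-ζ^2) * (-log ζ)) ≤ G ζ := by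
    intro ζ hζ
    have := mul_le_mul_of_nonneg_left (hge ζ hζ) (hw ζ hζ).le
    simp only [hG]; linarith
  have hGc : ContinuousOn G (Ioo 0 1) := by
    have hc1 : ContinuousOn (fun ζ : ℝ => ψ (a*ζ^2)) (Ioo 0 1) :=
      hcont.comp (by fun_prop) (fun ζ hζ => by
        have := hζ.1; exact (show 0 < a*ζ^2 by positivity))
    have hc2 : ContinuousOn (fun ζ : ℝ => ψ (a/ζ^2)) (Ioo 0 1) :=
      hcont.comp (continuousOn_const.div (by fun_prop) (fun ζ hζ => by
        have := hζ.1; positivity)) (fun ζ hζ => by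
        have := hζ.1; exact (show 0 < a/ζ^2 by positivity))
    have hc3 : ContinuousOn (fun ζ : ℝ => (1/(1-ζ^2)) *
        Real.log ((ψ a - ψ (a*ζ^2)) / (ψ (a/ζ^2) - ψ a) / ζ^2)) (Ioo 0 1) := by
      refine ContinuousOn.mul (continuousOn_const.div (by fun_prop) fun ζ hζ => ?_)
        (ContinuousOn.log (((continuousOn_const.sub hc1).div (hc2.sub continuousOn_const)
          fun ζ hζ => (hB ζ hζ).ne').div (by fun_prop) fun ζ hζ => ?_) fun ζ hζ => ?_)
      · nlinarith [hζ.1, hζ.2]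
      · have := hζ.1; positivity
      · have := hζ.1
        have := hA ζ hζ
        have := hB ζ hζ
        positivity
    refine hc3.congr fun ζ hζ => ?_
    simp only [hG]; rw [hR ζ hζ]
  have hGi : IntegrableOn G (Ioo 0 1) := by
    refine (hI.const_mul (2*κ₁)).mono' (hGc.aestronglyMeasurable measurableSet_Ioo) ?_
    filter_upwards [ae_restrict_mem measurableSet_Ioo] with ζ hζ
    rw [Real.norm_of_nonneg]
    · exact hGle ζ hζ
    · refine le_trans ?_ (hGge ζ hζ)
      have := Real.log_nonpos hζ.1.le hζ.2.le
      have h3 : 0 ≤ 1/(1-ζ^2) * (-log ζ) := mul_nonneg (hw ζ hζ).le (by linarith)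
      positivity
  have hL := setIntegral_mono_on (hI.const_mul (2*κ₀)) hGi measurableSet_Ioo hGge
  have hU := setIntegral_mono_on hGi (hI.const_mul (2*κ₁)) measurableSet_Ioo hGle
  rw [integral_const_mul, hIv] at hL hU
  have e : ∀ κ : ℝ, κ * (π/4) = 1/π * (2*κ*(π^2/8)) := by
    intro κ; field_simp; ring
  rw [e, e]
  have hpi : 0 ≤ 1/π := by positivity
  exact ⟨mul_le_mul_of_nonneg_left hL hpi, mul_le_mul_of_nonneg_left hU hpi⟩
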